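/- No change of measure makes the supercritical power law graphop numerically bounded: Let α ∈ (1/2, 1) and define the power law graphop (A_α f)(ξ) := (1−α)² ξ^{−α} ∫₀¹ x^{−α} f(x) dx for functions f on [0,1]. Then there is NO Borel probability measure μ̃ on [0,1] with supp μ̃ = [0,1] such that the numerical radius n_{μ̃}(A_α) := sup{∫₀¹ f(ξ)(A_α f)(ξ) dμ̃(ξ) : f ∈ L^∞([0,1], μ̃), ‖f‖_{L²([0,1],μ̃)} = 1} is finite; i.e., for every such μ̃ this supremum is +∞. -/

import Mathlib

open MeasureTheory Real

noncomputable section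

/-- The power law graphop on `[0,1]`:
`(A_α f)(ξ) = (1-α)² ξ^{-α} ∫₀¹ x^{-α} f(x) dx` (Lebesgue integral). -/
def powerLawOp (α : ℝ) (f : ℝ → ℝ) (ξ : ℝ) : ℝ :=
  (1 - α) ^ 2 * ξ ^ (-α) * ∫ x in Set.Ioc (0:ℝ) 1, x ^ (-α) * f x

lemma aux_lower {α δ : ℝ} (hα : 0 < α) (hδ : 0 < δ) (μ : Measure ℝ) [IsFiniteMeasure μ] :
    (2 * δ) ^ (-α) * μ.real (Set.Ioo δ (2 * δ)) ≤
      ∫ x, x ^ (-α) * (Set.Ioo δ (2 * δ)).indicator (fun _ => (1:ℝ)) x ∂μ := by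
  have h1 : (fun x : ℝ => x ^ (-α) * (Set.Ioo δ (2 * δ)).indicator (fun _ => (1:ℝ)) x) =
      (Set.Ioo δ (2 * δ)).indicator (fun x => x ^ (-α)) := by
    funext x
    by_cases hx : x ∈ Set.Ioo δ (2 * δ) <;> simp [hx]
  rw [h1, integral_indicator measurableSet_Ioo]
  have hint : IntegrableOn (fun x : ℝ => x ^ (-α)) (Set.Ioo δ (2 * δ)) μ := by
    refine IntegrableOn.mono_set (t := Set.Icc δ (2 * δ)) ?_ Set.Ioo_subset_Icc_self
    refine ContinuousOn.integrableOn_compact isCompact_Icc ?_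
    intro x hx
    exact (Real.continuousAt_rpow_const x (-α)
      (Or.inl (hδ.trans_le hx.1).ne')).continuousWithinAt
  have h2 := setIntegral_mono_on (μ := μ) (s := Set.Ioo δ (2 * δ))
    (f := fun _ => (2 * δ) ^ (-α)) (integrable_const _) hint measurableSet_Ioo
    (fun x hx => Real.rpow_le_rpow_of_nonpos (hδ.trans hx.1) hx.2.le (by linarith))
  rw [setIntegral_const, smul_eq_mul] at h2
  linarith

/-- For `α ∈ (1/2, 1)` no Borel probability measure `ν` on `[0,1]` with full support makes
the power law graphop `A_α` numerically bounded: the set of values `∫ f (A_α f) dν` over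
essentially bounded `f` with `‖f‖_{L²(ν)} = 1` is unbounded above, i.e. the numerical
radius `n_ν(A_α)` is `+∞`. -/
theorem powerlaw_no_measure_numerically_bounded
    {α : ℝ} (hα : 1 / 2 < α) (hα1 : α < 1)
    (ν : Measure ℝ) [IsProbabilityMeasure ν]
    -- `supp ν = [0,1]`
    (hνIcc : ν (Set.Icc (0:ℝ) 1) = 1)
    (hνfull : ∀ U : Set ℝ, IsOpen U → (U ∩ Set.Icc (0:ℝ) 1).Nonempty → 0 < ν U) :
    ¬ BddAbove {r : ℝ | ∃ f : ℝ → ℝ, (∃ C : ℝ, ∀ᵐ x ∂ν, |f x| ≤ C) ∧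
      MemLp f 2 ν ∧ (∫ x, (f x) ^ 2 ∂ν) = 1 ∧
      r = ∫ ξ, f ξ * powerLawOp α f ξ ∂ν} := by
  rintro ⟨M, hM⟩
  have hc : 0 < (1 - α) ^ 2 := by have : 0 < 1 - α := by linarith
                                  positivity
  obtain ⟨y, hy1, hyM⟩ : ∃ y : ℝ, 1 ≤ y ∧ M < (1 - α) ^ 2 / 2 * y ^ (2 * α - 1) := by
    have ht := (tendsto_rpow_atTop (show 0 < 2 * α - 1 by linarith)).const_mul_atTop
      (show 0 < (1 - α) ^ 2 / 2 by positivity)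
    obtain ⟨y, h1, h2⟩ := ((Filter.eventually_ge_atTop (1:ℝ)).and
      (ht.eventually_gt_atTop M)).exists
    exact ⟨y, h1, h2⟩
  have hy0 : 0 < y := by linarith
  set δ : ℝ := y⁻¹ / 2 with hδdef
  have hδ : 0 < δ := by positivity
  have h2δ : 2 * δ = y⁻¹ := by rw [hδdef]; ring
  have h2δ1 : 2 * δ ≤ 1 := by rw [h2δ]; exact inv_le_one_of_one_le₀ hy1
  set I := Set.Ioo δ (2 * δ) with hI
  have hp : 0 < ν.real I := by
    refine ENNReal.toReal_pos (hνfull I isOpen_Ioo ⟨3 / 2 * δ, ?_, ?_⟩).ne' (measure_ne_top _ _)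
    · constructor <;> linarith
    · constructor <;> linarith
  set p := ν.real I with hpdef
  set s := (√p)⁻¹ with hs
  have hs0 : 0 < s := by positivity
  have hsp : s ^ 2 * p = 1 := by
    rw [hs, inv_pow, Real.sq_sqrt hp.le]; field_simp
  have hA := aux_lower (α := α) (by linarith) hδ ν
  have hB := aux_lower (α := α) (by linarith) hδ (volume.restrict (Set.Ioc (0:ℝ) 1))
  have hvol : (volume.restrict (Set.Ioc (0:ℝ) 1)).real (Set.Ioo δ (2 * δ)) = δ := by
    rw [measureReal_restrict_apply measurableSet_Ioo, Set.inter_eq_left.mpr]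
    · rw [Real.volume_real_Ioo_of_le (by linarith)]; ring
    · intro x hx
      exact ⟨hδ.trans hx.1, hx.2.le.trans h2δ1⟩
  rw [hvol] at hB
  rw [← hI, ← hpdef] at hA
  rw [← hI] at hB
  set e : ℝ → ℝ := I.indicator (fun _ => (1:ℝ)) with he
  set J := ∫ x in Set.Ioc (0:ℝ) 1, x ^ (-α) * e x with hJ
  set K := ∫ x, x ^ (-α) * e x ∂ν with hK
  have he2 : ∀ x, e x ^ 2 = e x := by
    intro x
    by_cases hx : x ∈ I <;> simp [he, hx]
  have heabs : ∀ x, |e x| ≤ 1 := by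
    intro x
    by_cases hx : x ∈ I <;> simp [he, hx]
  have hem : Measurable e := measurable_const.indicator measurableSet_Ioo
  have hb : ∀ x, |s * e x| ≤ s := by
    intro x
    rw [abs_mul, abs_of_pos hs0]
    nlinarith [heabs x]
  have hmem := hM (a := s ^ 2 * (1 - α) ^ 2 * J * K) ⟨fun x => s * e x,
    ⟨s, Filter.Eventually.of_forall hb⟩,
    MemLp.of_bound (hem.const_mul s).aestronglyMeasurable s (Filter.Eventually.of_forall hb),
    ?_, ?_⟩
  · have hq : 0 < (2 * δ) ^ (-α) := by positivity
    have h3 : ((2 * δ) ^ (-α) * δ) * ((2 * δ) ^ (-α) * p) ≤ J * K :=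
      mul_le_mul hB hA (by positivity) ((by positivity : 0 ≤ (2 * δ) ^ (-α) * δ).trans hB)
    have h4 : (1 - α) ^ 2 / 2 * y ^ (2 * α - 1) =
        s ^ 2 * (1 - α) ^ 2 * (((2 * δ) ^ (-α) * δ) * ((2 * δ) ^ (-α) * p)) := by
      have h5 : (2 * δ) ^ (-α) = y ^ α := by
        rw [h2δ, Real.inv_rpow hy0.le, Real.rpow_neg hy0.le, inv_inv]
      have h6 : y ^ (2 * α - 1) = y ^ α * y ^ α * y⁻¹ := by
        rw [show 2 * α - 1 = α + α + (-1) by ring, Real.rpow_add hy0, Real.rpow_add hy0,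
          Real.rpow_neg_one]
      rw [h5, h6, hδdef]
      linear_combination (-((1 - α) ^ 2 * y ^ α * y ^ α * y⁻¹ / 2)) * hsp
    have h7 := mul_le_mul_of_nonneg_left h3 (show 0 ≤ s ^ 2 * (1 - α) ^ 2 by positivity)
    rw [← h4] at h7
    linarith
  · simp only [mul_pow, he2]
    rw [integral_const_mul, he, integral_indicator measurableSet_Ioo, setIntegral_const]
    simpa using hsp
  · have h8 : (∫ x in Set.Ioc (0:ℝ) 1, x ^ (-α) * (s * e x)) = s * J := by
      rw [hJ, ← integral_const_mul]
      congr 1; funext x; ring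
    simp only [powerLawOp, h8]
    rw [hK, ← integral_const_mul]
    congr 1; funext x; ring
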